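/- Let ε ≥ 0 and suppose det(L_S) > 0 for every S ⊆ 𝒴 with |S| ≤ k. Suppose that for every core c ∈ C, all u, v ∈ 𝒴_c, and every S ⊆ 𝒴 with |S| = k−1, S singular with respect to Π, and S ∩ 𝒴_c = ∅, one has det(L_{S ∪ {u}}) ≤ (1+ε) · det(L_{S ∪ {v}}). Then for every k-singular set Y ⊆ 𝒴 and every subset T ⊆ Y, the partially replaced set Y' = (Y \ T) ∪ {c(y) : y ∈ T} satisfies (1+ε)^{−|T|} · det(L_Y) ≤ det(L_{Y'}) ≤ (1+ε)^{|T|} · det(L_Y), where det(L_{Y'}) is the determinant of the k×k matrix indexed by Y whose (i,j) entry is L_{r(i),r(j)} with r(y) = c(y) for y ∈ T and r(y) = y otherwise. -/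

import Mathlib

open Matrix Finset

variable {𝒴 : Type*}

/-- Principal minor of `A` indexed by the finite set `S`:
the determinant of the principal submatrix `A_S`. -/
noncomputable def pminor [DecidableEq 𝒴] (A : Matrix 𝒴 𝒴 ℝ) (S : Finset 𝒴) : ℝ :=
  (A.submatrix (fun i : S => (i : 𝒴)) (fun j : S => (j : 𝒴))).det

/-- `Y` is singular with respect to the partition whose parts are the fibers of the
core map `part` (so `𝒴_c = part⁻¹(c)`): every part contains at most one element of `Y`. -/
def IsSingular [DecidableEq 𝒴] (part : 𝒴 → 𝒴) (Y : Finset 𝒴) : Prop :=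
  ∀ c : 𝒴, (Y.filter fun y => part y = c).card ≤ 1

instance [DecidableEq 𝒴] [Fintype 𝒴] (part : 𝒴 → 𝒴) : DecidablePred (IsSingular part) :=
  fun _ => by unfold IsSingular; infer_instance

/-- The size `|𝒴_c|` of the part with core `c`. -/
def psize [Fintype 𝒴] [DecidableEq 𝒴] (part : 𝒴 → 𝒴) (c : 𝒴) : ℕ :=
  (Finset.univ.filter fun y => part y = c).card

/-- The rescaled core kernel `L̃` with entries `L̃_{c,c'} = sqrt(|𝒴_c|·|𝒴_{c'}|)·L_{c,c'}`. -/
noncomputable def coreK [Fintype 𝒴] [DecidableEq 𝒴] (L : Matrix 𝒴 𝒴 ℝ) (part : 𝒴 → 𝒴) :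
    Matrix 𝒴 𝒴 ℝ :=
  fun i j => Real.sqrt ((psize part i : ℝ) * (psize part j : ℝ)) * L i j

theorem pminor_submatrix_image [DecidableEq 𝒴] (L : Matrix 𝒴 𝒴 ℝ) (r : 𝒴 → 𝒴) (Y : Finset 𝒴)
    (hr : Set.InjOn r Y) : pminor (L.submatrix r r) Y = pminor L (Y.image r) := by
  unfold pminor
  let f : Y → (Y.image r) := fun y => ⟨r y, Finset.mem_image_of_mem r y.2⟩
  have hf : Function.Bijective f := by
    constructor
    · intro a b h
      exact Subtype.ext (hr a.2 b.2 (congrArg Subtype.val h))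
    · rintro ⟨b, hb⟩
      obtain ⟨a, ha, rfl⟩ := Finset.mem_image.1 hb
      exact ⟨⟨a, ha⟩, rfl⟩
  rw [← Matrix.det_submatrix_equiv_self (Equiv.ofBijective f hf)]
  rfl

theorem isSingular_iff_injOn [DecidableEq 𝒴] (part : 𝒴 → 𝒴) (Y : Finset 𝒴) :
    IsSingular part Y ↔ Set.InjOn part Y := by
  unfold IsSingular
  constructor
  · intro h a ha b hb hab
    exact Finset.card_le_one.1 (h (part b)) a (by simp_all) b (by simp_all)
  · intro h c
    refine Finset.card_le_one.2 fun a ha b hb => ?_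
    simp only [Finset.mem_filter] at ha hb
    exact h ha.1 hb.1 (ha.2.trans hb.2.symm)

/-- under the same distortion hypothesis, for every `k`-singular `Y` and every
`T ⊆ Y`, replacing exactly the elements of `T` by their cores distorts the determinant by a
factor of at most `(1+ε)^{|T|}`.  The determinant of the partially replaced set is encoded as
the determinant of the `k×k` matrix indexed by `Y` with entries `L_{r(i),r(j)}`, where
`r(y) = c(y)` for `y ∈ T` and `r(y) = y` otherwise. -/
theorem det_partially_replaced_distortion_bound
    [Fintype 𝒴] [DecidableEq 𝒴]
    (L : Matrix 𝒴 𝒴 ℝ) (hL : L.PosSemidef)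
    (part : 𝒴 → 𝒴) (C : Finset 𝒴)
    (hmem : ∀ y, part y ∈ C) (hfix : ∀ c ∈ C, part c = c)
    (k : ℕ) (ε : ℝ) (hε : 0 ≤ ε)
    (hdet : ∀ S : Finset 𝒴, S.card ≤ k → 0 < pminor L S)
    (hdist : ∀ c ∈ C, ∀ u v : 𝒴, part u = c → part v = c →
      ∀ S : Finset 𝒴, S.card = k - 1 → IsSingular part S → (∀ s ∈ S, part s ≠ c) →
        pminor L (insert u S) ≤ (1 + ε) * pminor L (insert v S))
    (Y : Finset 𝒴) (hcard : Y.card = k) (hsing : IsSingular part Y)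
    (T : Finset 𝒴) (hT : T ⊆ Y) :
    ((1 + ε) ^ T.card)⁻¹ * pminor L Y
        ≤ pminor (L.submatrix (fun y => if y ∈ T then part y else y)
            (fun y => if y ∈ T then part y else y)) Y ∧
      pminor (L.submatrix (fun y => if y ∈ T then part y else y)
            (fun y => if y ∈ T then part y else y)) Y
        ≤ (1 + ε) ^ T.card * pminor L Y := by
  have hinj := (isSingular_iff_injOn part Y).1 hsing
  have hpp : ∀ y, part (part y) = part y := fun y => hfix _ (hmem y)
  have hpr : ∀ (T : Finset 𝒴) (y : 𝒴), part (if y ∈ T then part y else y) = part y := by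
    intro T y
    split_ifs
    · exact hpp y
    · rfl
  have hrinj : ∀ T : Finset 𝒴, Set.InjOn (fun y => if y ∈ T then part y else y) Y := by
    intro T a ha b hb hab
    apply hinj ha hb
    have := congrArg part hab
    simpa only [hpr] using this
  rw [pminor_submatrix_image L _ Y (hrinj T)]
  have h1 : 0 < 1 + ε := by linarith
  suffices h : pminor L Y ≤ (1 + ε) ^ T.card *
        pminor L (Y.image (fun y => if y ∈ T then part y else y)) ∧
      pminor L (Y.image (fun y => if y ∈ T then part y else y)) ≤
        (1 + ε) ^ T.card * pminor L Y from
    ⟨(inv_mul_le_iff₀ (pow_pos h1 _)).2 h.1, h.2⟩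
  induction T using Finset.induction_on with
  | empty => simp
  | insert a T haT ih =>
    obtain ⟨ih1, ih2⟩ := ih (fun x hx => hT (Finset.mem_insert_of_mem hx))
    have haY : a ∈ Y := hT (Finset.mem_insert_self a T)
    set S := (Y.erase a).image (fun y => if y ∈ T then part y else y) with hS
    have e1 : Y.image (fun y => if y ∈ T then part y else y) = insert a S := by
      conv_lhs => rw [← Finset.insert_erase haY]
      rw [Finset.image_insert, if_neg haT]
    have e2 : Y.image (fun y => if y ∈ insert a T then part y else y) = insert (part a) S := by
      conv_lhs => rw [← Finset.insert_erase haY]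
      rw [Finset.image_insert, if_pos (Finset.mem_insert_self a T), hS]
      congr 1
      apply Finset.image_congr
      intro y hy
      have hya : y ≠ a := Finset.ne_of_mem_erase hy
      simp [Finset.mem_insert, hya]
    have hScard : S.card = k - 1 := by
      rw [hS, Finset.card_image_of_injOn, Finset.card_erase_of_mem haY, hcard]
      exact (hrinj T).mono (by simp)
    have hSs : IsSingular part S := by
      rw [isSingular_iff_injOn]
      intro x hx y hy hxy
      obtain ⟨x', hx', rfl⟩ := Finset.mem_image.1 hx
      obtain ⟨y', hy', rfl⟩ := Finset.mem_image.1 hy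
      rw [hpr, hpr] at hxy
      rw [hinj (Finset.mem_of_mem_erase hx') (Finset.mem_of_mem_erase hy') hxy]
    have hSa : ∀ s ∈ S, part s ≠ part a := by
      intro x hx hxa
      obtain ⟨x', hx', rfl⟩ := Finset.mem_image.1 hx
      rw [hpr] at hxa
      exact Finset.ne_of_mem_erase hx' (hinj (Finset.mem_of_mem_erase hx') haY hxa)
    have d1 := hdist (part a) (hmem a) a (part a) rfl (hpp a) S hScard hSs hSa
    have d2 := hdist (part a) (hmem a) (part a) a (hpp a) rfl S hScard hSs hSa
    rw [e1] at ih1 ih2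
    rw [e2, Finset.card_insert_of_notMem haT, pow_succ]
    constructor
    · calc _ ≤ _ := ih1
        _ ≤ (1 + ε) ^ T.card * ((1 + ε) * pminor L (insert (part a) S)) := by gcongr
        _ = _ := by ring
    · calc _ ≤ _ := d2
        _ ≤ (1 + ε) * ((1 + ε) ^ T.card * pminor L Y) := by gcongr
        _ = _ := by ring
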